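/- There are absolute constants c* > 0 and C* ≥ 1 such that for every c > 0 there is n₀ ∈ ℕ with the following property for all n ≥ n₀. Let λ satisfy (1/64)·(log n)^{−4} ≤ λ ≤ c*, let d satisfy C*·log n ≤ d ≤ n/C* and dn even, let δ ≥ C*·log n satisfy λ·δ·d ≥ C*·log n, and set q = 2δ/n. Let K ~ G_d(n) and F ~ G(n,q) be independent. Then with probability at least 1 − c·n^{−14} the following holds: for each U ⊆ [n], if |U| ≤ λn/10⁴ and there is some W ⊆ [n] with |W| ≤ 4|U|/δ and U ⊆ W ∪ N_F(W), then e_K(U) ≤ (λ·d/2)·|U|. (Lemma 6.3, with the paper's hypothesis d = o(n) rendered as d ≤ n/C*.) -/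

import Mathlib

open scoped Classical ENNReal

noncomputable section

namespace Sandwich

variable {n : ℕ}

/-- The degree of the vertex `v` in the graph `G`. -/
def deg (G : SimpleGraph (Fin n)) (v : Fin n) : ℕ := Nat.card (G.neighborSet v)

/-- `G` is a `d`-regular graph. -/
def IsRegularGraph (G : SimpleGraph (Fin n)) (d : ℕ) : Prop := ∀ v, deg G v = d

/-- The number of edges of `G`. -/
def edgeCount (G : SimpleGraph (Fin n)) : ℕ := G.edgeSet.ncard

/-- The probability of the event `P` under the probability mass function `μ`. -/
def prEvent {α : Type*} (μ : PMF α) (P : α → Prop) : ℝ≥0∞ := ∑' a, if P a then μ a else 0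

/-- `μ` is the uniform distribution on the set `S`. -/
def IsUniformOn {α : Type*} (μ : PMF α) (S : Set α) : Prop :=
  ∀ a, μ a = if a ∈ S then (S.ncard : ℝ≥0∞)⁻¹ else 0

/-- `P` lists the `k+1` vertices of a `(G₁,G₂)`-alternating path of length `k`: the vertices
are distinct and consecutive vertices are joined by an edge of `G₁` (for steps of even index)
or of `G₂` (for steps of odd index). -/
def IsAltSeq (G₁ G₂ : SimpleGraph (Fin n)) (k : ℕ) (P : Fin (k + 1) → Fin n) : Prop :=
  Function.Injective P ∧
    ∀ i : Fin k, if (i : ℕ) % 2 = 0 then G₁.Adj (P i.castSucc) (P i.succ)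
      else G₂.Adj (P i.castSucc) (P i.succ)

/-- The number of `(G₁,G₂)`-alternating `x,y`-paths of length `k` with no internal vertex
in `Z`. -/
def altPathCount (G₁ G₂ : SimpleGraph (Fin n)) (k : ℕ) (x y : Fin n) (Z : Set (Fin n)) : ℕ :=
  Nat.card {P : Fin (k + 1) → Fin n // IsAltSeq G₁ G₂ k P ∧ P 0 = x ∧ P (Fin.last k) = y ∧
    ∀ i : Fin (k + 1), i ≠ 0 → i ≠ Fin.last k → P i ∉ Z}

/-- The number of `(G₁,G₂)`-alternating paths of length `k` starting at `x`. -/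
def altStartCount (G₁ G₂ : SimpleGraph (Fin n)) (k : ℕ) (x : Fin n) : ℕ :=
  Nat.card {P : Fin (k + 1) → Fin n // IsAltSeq G₁ G₂ k P ∧ P 0 = x}

/-- The external neighbourhood `N_G(U)` of a set of vertices `U`. -/
def nbhd (G : SimpleGraph (Fin n)) (U : Set (Fin n)) : Set (Fin n) :=
  {v | v ∉ U ∧ ∃ u ∈ U, G.Adj u v}

/-- `e_G(U)`, the number of edges of `G` with both endpoints in `U`. -/
def edgesWithin (G : SimpleGraph (Fin n)) (U : Set (Fin n)) : ℕ :=
  {e ∈ G.edgeSet | ∀ v ∈ e, v ∈ U}.ncard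

/-- `e_G(U,V) = |{(u,v) : u ∈ U, v ∈ V, uv ∈ E(G)}|`. -/
def edgesBetween (G : SimpleGraph (Fin n)) (U V : Set (Fin n)) : ℕ :=
  {p : Fin n × Fin n | p.1 ∈ U ∧ p.2 ∈ V ∧ G.Adj p.1 p.2}.ncard

/-- `|E_{≥2,G}(U)|`, the number of edges `xy ∈ E(G)` with `x ∈ U`, `y ∉ U` such that some
`x' ∈ U ∖ {x}` also satisfies `x'y ∈ E(G)`. -/
def E2count (G : SimpleGraph (Fin n)) (U : Set (Fin n)) : ℕ :=
  {e : Sym2 (Fin n) | e ∈ G.edgeSet ∧ ∃ x y, e = s(x, y) ∧ x ∈ U ∧ y ∉ U ∧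
    ∃ x' ∈ U, x' ≠ x ∧ G.Adj x' y}.ncard

/-- `Σ_{u ∈ N_{F∖K}(v)} Σ_{u' ∈ N_K(u)} d_{F∖K}(u')`. -/
def doubleDegSum (F K : SimpleGraph (Fin n)) (v : Fin n) : ℝ :=
  ∑ u : Fin n, if (F \ K).Adj v u then
    ∑ u' : Fin n, if K.Adj u u' then (deg (F \ K) u' : ℝ) else 0
  else 0

/-- `μ` is the law of the binomial random graph `G(n,p)`. -/
def IsGnp (μ : PMF (SimpleGraph (Fin n))) (p : ℝ) : Prop :=
  ∀ G, μ G = ENNReal.ofReal (p ^ edgeCount G * (1 - p) ^ (n.choose 2 - edgeCount G))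

/-- `μ` is the law of `G(n,p)`, where `p` is truncated to `[0,1]` (so that `G(n,p)` is the
empty graph for `p ≤ 0` and the complete graph for `p ≥ 1`). -/
def IsGnpLaw (μ : PMF (SimpleGraph (Fin n))) (p : ℝ) : Prop :=
  IsGnp μ (max 0 (min p 1))

/-- `μ` is the law of `K + E`, where `E` includes each pair not in `E(K)` independently with
probability `p`. -/
def IsAddGnp (μ : PMF (SimpleGraph (Fin n))) (K : SimpleGraph (Fin n)) (p : ℝ) : Prop :=
  ∀ F, μ F = if K ≤ F then
      ENNReal.ofReal (p ^ (edgeCount F - edgeCount K) * (1 - p) ^ (n.choose 2 - edgeCount F))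
    else 0

/-- `ν` is the joint law of `(K, F)` where `K ~ G_d(n)` is a uniformly random `d`-regular graph
and `F = K + E`, `E` including each pair not in `E(K)` independently with probability `p`. -/
def IsRegAddGnp (ν : PMF (SimpleGraph (Fin n) × SimpleGraph (Fin n))) (d : ℕ) (p : ℝ) : Prop :=
  ∀ w, ν w = if IsRegularGraph w.1 d ∧ w.1 ≤ w.2 then
      ({G : SimpleGraph (Fin n) | IsRegularGraph G d}.ncard : ℝ≥0∞)⁻¹ *
        ENNReal.ofReal (p ^ (edgeCount w.2 - edgeCount w.1) *
          (1 - p) ^ (n.choose 2 - edgeCount w.2))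
    else 0

/-- `ν` is the joint law of an independent pair `(K, F)` with `K ~ G_d(n)` and `F ~ G(n,q)`. -/
def IsRegIndepGnp (ν : PMF (SimpleGraph (Fin n) × SimpleGraph (Fin n))) (d : ℕ) (q : ℝ) :
    Prop :=
  ∀ w, ν w = (if IsRegularGraph w.1 d then
      ({G : SimpleGraph (Fin n) | IsRegularGraph G d}.ncard : ℝ≥0∞)⁻¹ else 0) *
      ENNReal.ofReal (q ^ edgeCount w.2 * (1 - q) ^ (n.choose 2 - edgeCount w.2))

lemma deg_eq_card (G : SimpleGraph (Fin n)) (v : Fin n) :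
    deg G v = (Finset.univ.filter (G.Adj v)).card := by
  rw [deg, Nat.card_eq_fintype_card, ← Set.toFinset_card]
  congr 1
  ext w
  simp

/-- The graph obtained from `K` by replacing the edges `uv`, `xy` with `ux`, `vy`. -/
def switch (K : SimpleGraph (Fin n)) (u v x y : Fin n) : SimpleGraph (Fin n) :=
  SimpleGraph.fromEdgeSet ((K.edgeSet \ {s(u, v), s(x, y)}) ∪ {s(u, x), s(v, y)})

/-- `uv` and `xy` are edges of `K` which can be switched to the non-edges `ux` and `vy`. -/
structure Switchable (K : SimpleGraph (Fin n)) (u v x y : Fin n) : Prop where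
  adj_uv : K.Adj u v
  adj_xy : K.Adj x y
  ne_ux : u ≠ x
  ne_vy : v ≠ y
  not_adj_ux : ¬ K.Adj u x
  not_adj_vy : ¬ K.Adj v y

namespace Switchable

variable {K : SimpleGraph (Fin n)} {u v x y : Fin n}

lemma ne_uv (h : Switchable K u v x y) : u ≠ v := h.adj_uv.ne

lemma ne_xy (h : Switchable K u v x y) : x ≠ y := h.adj_xy.ne

lemma ne_uy (h : Switchable K u v x y) : u ≠ y := by
  rintro rfl
  exact h.not_adj_vy h.adj_uv.symm

lemma ne_vx (h : Switchable K u v x y) : v ≠ x := by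
  rintro rfl
  exact h.not_adj_ux h.adj_uv

lemma flip (h : Switchable K u v x y) : Switchable K v u y x :=
  ⟨h.adj_uv.symm, h.adj_xy.symm, h.ne_vy, h.ne_ux, h.not_adj_vy, h.not_adj_ux⟩

lemma swap (h : Switchable K u v x y) : Switchable K x y u v :=
  ⟨h.adj_xy, h.adj_uv, h.ne_ux.symm, h.ne_vy.symm, fun k => h.not_adj_ux k.symm,
    fun k => h.not_adj_vy k.symm⟩

end Switchable

lemma switch_adj (K : SimpleGraph (Fin n)) (u v x y a b : Fin n) :
    (switch K u v x y).Adj a b ↔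
      ((K.Adj a b ∧ s(a, b) ≠ s(u, v) ∧ s(a, b) ≠ s(x, y)) ∨
        s(a, b) = s(u, x) ∨ s(a, b) = s(v, y)) ∧ a ≠ b := by
  simp only [switch, SimpleGraph.fromEdgeSet_adj, Set.mem_union, Set.mem_sdiff, Set.mem_insert_iff,
    Set.mem_singleton_iff, SimpleGraph.mem_edgeSet, not_or, ne_eq]

lemma switch_flip (K : SimpleGraph (Fin n)) (u v x y : Fin n) :
    switch K v u y x = switch K u v x y := by
  simp only [switch, Sym2.eq_swap (a := v) (b := u), Sym2.eq_swap (a := y) (b := x),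
    Set.pair_comm s(v, y)]

lemma switch_swap (K : SimpleGraph (Fin n)) (u v x y : Fin n) :
    switch K x y u v = switch K u v x y := by
  simp only [switch, Sym2.eq_swap (a := x) (b := u), Sym2.eq_swap (a := y) (b := v),
    Set.pair_comm s(x, y)]

lemma Switchable.switch_switch {K : SimpleGraph (Fin n)} {u v x y : Fin n}
    (h : Switchable K u v x y) : switch (switch K u v x y) u x v y = K := by
  have h1 := h.adj_uv
  have h2 := h.adj_xy
  have h3 := h.not_adj_ux
  have h4 := h.not_adj_vy
  have h5 := h1.symm
  have h6 := h2.symm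
  have h7 : ¬ K.Adj x u := fun k => h3 k.symm
  have h8 : ¬ K.Adj y v := fun k => h4 k.symm
  have h9 := h.ne_ux
  have h10 := h.ne_vy
  have h11 := h.ne_uy
  have h12 := h.ne_vx
  have h13 := h.ne_uv
  have h14 := h.ne_xy
  ext a b
  have h0 : K.Adj a b → a ≠ b := fun k => k.ne
  simp only [switch_adj, ne_eq, Sym2.eq_iff]
  grind

lemma Switchable.deg_switch_left {K : SimpleGraph (Fin n)} {u v x y : Fin n}
    (h : Switchable K u v x y) : deg (switch K u v x y) u = deg K u := by
  have h9 := h.ne_ux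
  have h10 := h.ne_vy
  have h11 := h.ne_uy
  have h12 := h.ne_vx
  have h13 := h.ne_uv
  have key : Finset.univ.filter ((switch K u v x y).Adj u) =
      insert x ((Finset.univ.filter (K.Adj u)).erase v) := by
    ext b
    have h0 : K.Adj u b → u ≠ b := fun k => k.ne
    simp only [Finset.mem_filter, Finset.mem_univ, true_and, Finset.mem_insert,
      Finset.mem_erase, switch_adj, ne_eq, Sym2.eq_iff]
    grind
  rw [deg_eq_card, deg_eq_card, key, Finset.card_insert_of_notMem, Finset.card_erase_add_one]
  · simpa using h.adj_uv
  · simp [h.not_adj_ux]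

lemma Switchable.deg_switch {K : SimpleGraph (Fin n)} {u v x y : Fin n}
    (h : Switchable K u v x y) (a : Fin n) : deg (switch K u v x y) a = deg K a := by
  by_cases hu : a = u
  · subst hu
    exact h.deg_switch_left
  by_cases hv : a = v
  · subst hv
    rw [← switch_flip]
    exact h.flip.deg_switch_left
  by_cases hx : a = x
  · subst hx
    rw [← switch_swap]
    exact h.swap.deg_switch_left
  by_cases hy : a = y
  · subst hy
    rw [← switch_swap, ← switch_flip]
    exact h.swap.flip.deg_switch_left
  rw [deg_eq_card, deg_eq_card]
  congr 1
  ext b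
  have h0 : K.Adj a b → a ≠ b := fun k => k.ne
  simp only [Finset.mem_filter, Finset.mem_univ, true_and, switch_adj, ne_eq, Sym2.eq_iff]
  grind

/-- The `d`-regular graphs on `[n]` whose edge set contains `S`. -/
def regularContaining (d : ℕ) (S : Finset (Sym2 (Fin n))) : Finset (SimpleGraph (Fin n)) :=
  Finset.univ.filter fun K => IsRegularGraph K d ∧ (S : Set (Sym2 (Fin n))) ⊆ K.edgeSet

lemma mem_regularContaining {d : ℕ} {S : Finset (Sym2 (Fin n))} {K : SimpleGraph (Fin n)} :
    K ∈ regularContaining d S ↔ IsRegularGraph K d ∧ ∀ e ∈ S, e ∈ K.edgeSet := by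
  simp [regularContaining, Set.subset_def]

/-- The ordered edges `(x, y)` outside `S` along which the edge `uv` can be switched. -/
def switchPairs (K : SimpleGraph (Fin n)) (S : Finset (Sym2 (Fin n))) (u v : Fin n) :
    Finset (Fin n × Fin n) :=
  Finset.univ.filter fun p => Switchable K u v p.1 p.2 ∧ s(p.1, p.2) ∉ S

lemma card_filter_adj_fst_mem (K : SimpleGraph (Fin n)) {d : ℕ} (hK : IsRegularGraph K d)
    (A : Finset (Fin n)) :
    (Finset.univ.filter fun p : Fin n × Fin n => p.1 ∈ A ∧ K.Adj p.1 p.2).card = A.card * d := by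
  have : (Finset.univ.filter fun p : Fin n × Fin n => p.1 ∈ A ∧ K.Adj p.1 p.2).card =
      (A.sigma fun a => Finset.univ.filter (K.Adj a)).card := by
    refine Finset.card_bij' (fun p _ => ⟨p.1, p.2⟩) (fun p _ => (p.1, p.2)) ?_ ?_ ?_ ?_ <;> simp
  rw [this, Finset.card_sigma, Finset.sum_congr rfl fun a _ => (deg_eq_card K a).symm.trans (hK a)]
  simp

lemma card_filter_mk_mem_le (S : Finset (Sym2 (Fin n))) :
    (Finset.univ.filter fun p : Fin n × Fin n => s(p.1, p.2) ∈ S).card ≤ 2 * S.card := by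
  refine Finset.card_le_mul_card_image_of_maps_to 
    (f := fun p : Fin n × Fin n => s(p.1, p.2))
    (fun p hp => (Finset.mem_filter.1 hp).2) 2 ?_
  intro e _
  induction e with
  | _ a b =>
    refine (Finset.card_le_card (t := {(a, b), (b, a)}) ?_).trans Finset.card_le_two
    rintro ⟨p, q⟩ hp
    simpa using (Finset.mem_filter.1 hp).2

lemma le_card_switchPairs (K : SimpleGraph (Fin n)) {d : ℕ} (hK : IsRegularGraph K d)
    (S : Finset (Sym2 (Fin n))) {u v : Fin n} (huv : K.Adj u v) :
    n * d ≤ (switchPairs K S u v).card + 2 * ((d + 1) * d) + 2 * S.card := by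
  set A : Fin n → Finset (Fin n) := fun a => insert a (Finset.univ.filter (K.Adj a)) with hA
  have hcA : ∀ a, (A a).card ≤ d + 1 := fun a =>
    (Finset.card_insert_le _ _).trans (by rw [← deg_eq_card, hK a])
  have h1 := card_filter_adj_fst_mem K hK Finset.univ
  have h2 := card_filter_adj_fst_mem K hK (A u)
  have h3 := card_filter_adj_fst_mem K hK (A v)
  have h3' : (Finset.univ.filter fun p : Fin n × Fin n => p.2 ∈ A v ∧ K.Adj p.1 p.2).card =
      (Finset.univ.filter fun p : Fin n × Fin n => p.1 ∈ A v ∧ K.Adj p.1 p.2).card := by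
    refine Finset.card_bij' (fun p _ => p.swap) (fun p _ => p.swap) ?_ ?_ ?_ ?_ <;>
      simp [K.adj_comm]
  have h4 := card_filter_mk_mem_le S
  have hsub : (Finset.univ.filter fun p : Fin n × Fin n => p.1 ∈ Finset.univ ∧ K.Adj p.1 p.2) ⊆
      ((switchPairs K S u v ∪
        Finset.univ.filter fun p : Fin n × Fin n => p.1 ∈ A u ∧ K.Adj p.1 p.2) ∪
        Finset.univ.filter fun p : Fin n × Fin n => p.2 ∈ A v ∧ K.Adj p.1 p.2) ∪
        Finset.univ.filter fun p : Fin n × Fin n => s(p.1, p.2) ∈ S := by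
    rintro ⟨x, y⟩ hp
    simp only [Finset.mem_filter, Finset.mem_univ, true_and] at hp
    simp only [Finset.mem_union, Finset.mem_filter, Finset.mem_univ, true_and, switchPairs, hA,
      Finset.mem_insert]
    by_contra hcon
    push Not at hcon
    obtain ⟨⟨⟨c1, c2⟩, c3⟩, c4⟩ := hcon
    refine c4 (c1 ⟨huv, hp, ?_, ?_, ?_, ?_⟩)
    · rintro rfl; exact c2 (Or.inl rfl) hp
    · rintro rfl; exact c3 (Or.inl rfl) hp
    · intro k; exact c2 (Or.inr k) hp
    · intro k; exact c3 (Or.inr k) hp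
  have h5 := Finset.card_le_card hsub
  have h6 := Finset.card_union_le ((switchPairs K S u v ∪
        Finset.univ.filter fun p : Fin n × Fin n => p.1 ∈ A u ∧ K.Adj p.1 p.2) ∪
        Finset.univ.filter fun p : Fin n × Fin n => p.2 ∈ A v ∧ K.Adj p.1 p.2)
        (Finset.univ.filter fun p : Fin n × Fin n => s(p.1, p.2) ∈ S)
  have h7 := Finset.card_union_le (switchPairs K S u v ∪
        Finset.univ.filter fun p : Fin n × Fin n => p.1 ∈ A u ∧ K.Adj p.1 p.2)
        (Finset.univ.filter fun p : Fin n × Fin n => p.2 ∈ A v ∧ K.Adj p.1 p.2)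
  have h8 := Finset.card_union_le (switchPairs K S u v)
        (Finset.univ.filter fun p : Fin n × Fin n => p.1 ∈ A u ∧ K.Adj p.1 p.2)
  have h9 := Nat.mul_le_mul_right d (hcA u)
  have h10 := Nat.mul_le_mul_right d (hcA v)
  rw [Finset.card_univ, Fintype.card_fin] at h1
  omega

/-- Switching bound: prescribing one more edge costs a factor `2d/n`. -/
lemma card_regularContaining_insert_le {d : ℕ} (hd : 1 ≤ d) (hdn : 16 * d ≤ n)
    (S : Finset (Sym2 (Fin n))) (e : Sym2 (Fin n)) (heS : e ∉ S)
    (hS : 8 * (S.card + 1) ≤ d * n) :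
    n * (regularContaining d (insert e S)).card ≤ 2 * d * (regularContaining d S).card := by
  induction e with
  | _ u v =>
  have hlow : ∀ K ∈ regularContaining d (insert s(u, v) S),
      n * d ≤ 2 * (switchPairs K (insert s(u, v) S) u v).card := by
    intro K hK
    obtain ⟨hreg, hcon⟩ := mem_regularContaining.1 hK
    have h1 := le_card_switchPairs K hreg (insert s(u, v) S)
      (show K.Adj u v from hcon _ (Finset.mem_insert_self _ _))
    rw [Finset.card_insert_of_notMem heS] at h1
    have h2 : 16 * d * d ≤ n * d := Nat.mul_le_mul_right d hdn
    nlinarith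
  have hcount : ((regularContaining d (insert s(u, v) S)).sigma
        fun K => switchPairs K (insert s(u, v) S) u v).card ≤
      ((regularContaining d S).sigma fun K =>
        (Finset.univ.filter (K.Adj u)) ×ˢ (Finset.univ.filter (K.Adj v))).card := by
    refine Finset.card_le_card_of_injOn (fun z => ⟨switch z.1 u v z.2.1 z.2.2, z.2⟩) ?_ ?_
    · rintro ⟨K, x, y⟩ hz
      simp only [Finset.coe_sigma, Set.mem_sigma_iff, Finset.mem_coe, mem_regularContaining,
        switchPairs, Finset.mem_filter, Finset.mem_univ, true_and, Finset.mem_insert,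
        not_or] at hz
      obtain ⟨⟨hreg, hcon⟩, hsw, hne, hxyS⟩ := hz
      simp only [Finset.coe_sigma, Set.mem_sigma_iff, Finset.mem_coe, mem_regularContaining,
        Finset.mem_product, Finset.mem_filter, Finset.mem_univ, true_and]
      refine ⟨⟨fun a => (hsw.deg_switch a).trans (hreg a), ?_⟩, ?_, ?_⟩
      · intro f hf
        induction f with
        | _ a b =>
          have hab : K.Adj a b := hcon _ (Or.inr hf)
          rw [SimpleGraph.mem_edgeSet, switch_adj]
          refine ⟨Or.inl ⟨hab, ?_, ?_⟩, hab.ne⟩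
          · intro k; exact heS (k ▸ hf)
          · intro k; exact hxyS (k ▸ hf)
      · simp [switch_adj, hsw.ne_ux]
      · simp [switch_adj, hsw.ne_vy]
    · rintro ⟨K, x, y⟩ hz ⟨K', x', y'⟩ hz' heq
      simp only [Finset.coe_sigma, Set.mem_sigma_iff, Finset.mem_coe, switchPairs,
        Finset.mem_filter, Finset.mem_univ, true_and] at hz hz'
      simp only [Sigma.mk.injEq, heq_eq_eq, Prod.mk.injEq] at heq
      obtain ⟨hK, rfl, rfl⟩ := heq
      have := hz.2.1.switch_switch
      rw [hK, hz'.2.1.switch_switch] at this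
      simp [this]
  rw [Finset.card_sigma, Finset.card_sigma] at hcount
  have hup : ∑ K ∈ regularContaining d S,
      ((Finset.univ.filter (K.Adj u)) ×ˢ (Finset.univ.filter (K.Adj v))).card =
      (regularContaining d S).card * (d * d) := by
    rw [Finset.sum_const_nat]
    intro K hK
    have hreg := (mem_regularContaining.1 hK).1
    rw [Finset.card_product, ← deg_eq_card, ← deg_eq_card, hreg, hreg]
  have hdown := Finset.card_nsmul_le_sum _ _ _ hlow
  rw [← Finset.mul_sum, smul_eq_mul] at hdown
  refine Nat.le_of_mul_le_mul_right ?_ (show 0 < d from hd)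
  nlinarith

lemma card_regularContaining_le {d : ℕ} (hd : 1 ≤ d) (hdn : 16 * d ≤ n)
    (S : Finset (Sym2 (Fin n))) (hS : 8 * S.card ≤ d * n) :
    ((regularContaining d S).card : ℝ) ≤
      (2 * d / n : ℝ) ^ S.card * (regularContaining (n := n) d ∅).card := by
  induction S using Finset.induction_on with
  | empty => simp
  | insert e S he ih =>
    rw [Finset.card_insert_of_notMem he] at hS ⊢
    have h1 := card_regularContaining_insert_le hd hdn S e he hS
    have h2 := ih (by omega)
    have hn : (0 : ℝ) < n := by exact_mod_cast (by omega : 0 < n)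
    have h3 : (n : ℝ) * (regularContaining d (insert e S)).card ≤
        2 * d * (regularContaining d S).card := by exact_mod_cast h1
    calc ((regularContaining d (insert e S)).card : ℝ)
        ≤ 2 * d / n * (regularContaining d S).card := by
          rw [div_mul_eq_mul_div, le_div_iff₀ hn]; linarith
      _ ≤ 2 * d / n * ((2 * d / n : ℝ) ^ S.card * (regularContaining (n := n) d ∅).card) := by
          gcongr
      _ = _ := by ring

lemma edgesWithin_eq_card (K : SimpleGraph (Fin n)) (X : Finset (Fin n)) :
    edgesWithin K X = (K.edgeFinset.filter fun e => ∀ v ∈ e, v ∈ X).card := by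
  rw [edgesWithin, ← Set.ncard_coe_finset]
  congr 1
  ext e
  simp

lemma edgesWithin_mono (K : SimpleGraph (Fin n)) {U V : Set (Fin n)} (h : U ⊆ V) :
    edgesWithin K U ≤ edgesWithin K V :=
  Set.ncard_le_ncard (fun _ he => ⟨he.1, fun v hv => h (he.2 v hv)⟩) (Set.toFinite _)

lemma choose_le_exp_mul_div_pow (a : ℕ) {k : ℕ} (hk : 0 < k) :
    (a.choose k : ℝ) ≤ (Real.exp 1 * a / k) ^ k := by
  have hk' : (0 : ℝ) < k := by exact_mod_cast hk
  have h1 : (a.choose k : ℝ) ≤ (a : ℝ) ^ k / k.factorial := Nat.choose_le_pow_div k a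
  have h2 : (k : ℝ) ^ k / k.factorial ≤ Real.exp k := Real.pow_div_factorial_le_exp _ hk'.le k
  have hf : (0 : ℝ) < k.factorial := by exact_mod_cast k.factorial_pos
  have h3 : Real.exp k = Real.exp 1 ^ k := by rw [← Real.exp_nat_mul, mul_one]
  calc (a.choose k : ℝ) ≤ (a : ℝ) ^ k / k.factorial := h1
    _ = (a : ℝ) ^ k / (k : ℝ) ^ k * ((k : ℝ) ^ k / k.factorial) := by field_simp
    _ ≤ (a : ℝ) ^ k / (k : ℝ) ^ k * Real.exp 1 ^ k := by rw [← h3]; gcongr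
    _ = (Real.exp 1 * a / k) ^ k := by rw [div_pow, mul_pow]; ring

/-- First-moment bound for the number of `d`-regular graphs with at least `m` edges in `X`. -/
lemma card_regular_le_edgesWithin {d : ℕ} (hd : 1 ≤ d) (hdn : 16 * d ≤ n)
    (X : Finset (Fin n)) (m : ℕ) (hm : 8 * m ≤ d * n) :
    (((regularContaining d ∅).filter fun K : SimpleGraph (Fin n) => m ≤ edgesWithin K X).card : ℝ) ≤
      ((X.card.choose 2).choose m : ℝ) * (2 * d / n : ℝ) ^ m *
        (regularContaining (n := n) d ∅).card := by
  set P : Finset (Sym2 (Fin n)) := X.offDiag.image Sym2.mk.uncurry with hP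
  have hPc : P.card = X.card.choose 2 := Sym2.card_image_offDiag X
  have hsub : ((regularContaining d ∅).filter
      fun K : SimpleGraph (Fin n) => m ≤ edgesWithin K X) ⊆
      (P.powersetCard m).biUnion fun S => regularContaining d S := by
    intro K hK
    rw [Finset.mem_filter, edgesWithin_eq_card, mem_regularContaining] at hK
    obtain ⟨S, hS, hSm⟩ := Finset.exists_subset_card_eq hK.2
    rw [Finset.mem_biUnion]
    refine ⟨S, Finset.mem_powersetCard.2 ⟨?_, hSm⟩, mem_regularContaining.2 ⟨hK.1.1, ?_⟩⟩
    · intro e he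
      have h1 := Finset.mem_filter.1 (hS he)
      induction e with
      | _ a b =>
        have hab : K.Adj a b := by simpa using h1.1
        exact Finset.mem_image.2 ⟨(a, b), Finset.mem_offDiag.2
          ⟨h1.2 a (by simp), h1.2 b (by simp), hab.ne⟩, rfl⟩
    · intro e he
      simpa using (Finset.mem_filter.1 (hS he)).1
  calc (((regularContaining d ∅).filter
        fun K : SimpleGraph (Fin n) => m ≤ edgesWithin K X).card : ℝ)
      ≤ ∑ S ∈ P.powersetCard m, ((regularContaining d S).card : ℝ) := by
        exact_mod_cast (Finset.card_le_card hsub).trans Finset.card_biUnion_le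
    _ ≤ ∑ S ∈ P.powersetCard m,
          (2 * d / n : ℝ) ^ m * (regularContaining (n := n) d ∅).card := by
        refine Finset.sum_le_sum fun S hS => ?_
        have hc := (Finset.mem_powersetCard.1 hS).2
        have := card_regularContaining_le hd hdn S (by rw [hc]; exact hm)
        rwa [hc] at this
    _ = _ := by
        rw [Finset.sum_const, Finset.card_powersetCard, hPc, nsmul_eq_mul]
        ring

/-- If `X` has at most `8δw` vertices, then few `d`-regular graphs have more than `λδdw/8` edges
inside `X`. -/
lemma card_regular_lt_edgesWithin {d : ℕ} (hd : 1 ≤ d) (hdn : 16 * d ≤ n)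
    {lam δ w : ℝ} (hlam : 0 < lam) (hlam1 : lam ≤ 1) (hδ : 0 < δ) (hw : 0 < w)
    (hwn : δ * w ≤ 4 * lam * n / 10 ^ 4) (X : Finset (Fin n)) (hX : (X.card : ℝ) ≤ 8 * δ * w) :
    (((regularContaining d ∅).filter
        fun K : SimpleGraph (Fin n) => lam * δ * d * w / 8 < edgesWithin K X).card : ℝ) ≤
      Real.exp (-(lam * δ * d * w / 16)) * (regularContaining (n := n) d ∅).card := by
  set r := lam * δ * d * w / 8 with hr
  have hd' : (1 : ℝ) ≤ d := by exact_mod_cast hd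
  have hdn' : 16 * (d : ℝ) ≤ n := by exact_mod_cast hdn
  have hn : (0 : ℝ) < n := by linarith
  have hr0 : 0 < r := by positivity
  set m := ⌊r⌋₊ + 1 with hm
  have hrm : r < m := by rw [hm]; push_cast; exact Nat.lt_floor_add_one r
  have hmr : (m : ℝ) ≤ r + 1 := by
    rw [hm]; push_cast; linarith [Nat.floor_le hr0.le]
  have hr1 : r ≤ d * n / 20000 := by
    have : r = lam * d * (δ * w) / 8 := by rw [hr]; ring
    have h2 : lam * d * (δ * w) ≤ 1 * d * (4 * 1 * n / 10 ^ 4) := by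
      gcongr
      exact hwn.trans (by gcongr)
    rw [this]; linarith
  have hm8 : 8 * m ≤ d * n := by
    have : (8 : ℝ) * m ≤ d * n := by nlinarith
    exact_mod_cast this
  have heq : ((regularContaining d ∅).filter
      fun K : SimpleGraph (Fin n) => r < edgesWithin K X) =
      (regularContaining d ∅).filter fun K : SimpleGraph (Fin n) => m ≤ edgesWithin K X := by
    refine Finset.filter_congr fun K _ => ?_
    rw [hm, Nat.succ_le_iff, Nat.floor_lt hr0.le]
  rw [heq]
  refine (card_regular_le_edgesWithin hd hdn X m hm8).trans ?_
  gcongr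
  have hM : ((X.card.choose 2 : ℕ) : ℝ) ≤ 32 * (δ * w) ^ 2 := by
    have h1 : ((X.card.choose 2 : ℕ) : ℝ) ≤ (X.card : ℝ) ^ 2 / (Nat.factorial 2 : ℕ) :=
      Nat.choose_le_pow_div 2 _
    have h2 : (X.card : ℝ) ^ 2 ≤ (8 * δ * w) ^ 2 := by gcongr
    norm_num at h1
    nlinarith
  have hbase : Real.exp 1 * ((X.card.choose 2 : ℕ) : ℝ) / m * (2 * d / n) ≤ Real.exp (-1 / 2) := by
    have h1 : Real.exp 1 * ((X.card.choose 2 : ℕ) : ℝ) / m * (2 * d / n) ≤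
        Real.exp 1 * (32 * (δ * w) ^ 2) / r * (2 * d / n) := by gcongr
    have h2 : Real.exp 1 * (32 * (δ * w) ^ 2) / r * (2 * d / n) =
        Real.exp 1 * 512 * (δ * w / (lam * n)) := by
      rw [hr]; field_simp; ring
    have h3 : δ * w / (lam * n) ≤ 4 / 10 ^ 4 := by
      rw [div_le_iff₀ (by positivity)]; linarith
    have h4 : Real.exp 1 * 512 * (δ * w / (lam * n)) ≤ Real.exp 1 * 512 * (4 / 10 ^ 4) := by
      gcongr
    have h5 := Real.exp_one_lt_d9
    have h6 : (0.6 : ℝ) ≤ Real.exp (-1 / 2) := by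
      have h7 : Real.exp (-1 / 2) * Real.exp (-1 / 2) * Real.exp 1 = 1 := by
        rw [← Real.exp_add, ← Real.exp_add]; norm_num
      by_contra hcon
      push Not at hcon
      have h8 := Real.exp_pos (-1 / 2 : ℝ)
      nlinarith [Real.exp_pos 1]
    linarith
  calc (((X.card.choose 2).choose m : ℕ) : ℝ) * (2 * d / n : ℝ) ^ m
      ≤ (Real.exp 1 * ((X.card.choose 2 : ℕ) : ℝ) / m) ^ m * (2 * d / n : ℝ) ^ m := by
        gcongr
        exact choose_le_exp_mul_div_pow _ (Nat.succ_pos _)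
    _ = (Real.exp 1 * ((X.card.choose 2 : ℕ) : ℝ) / m * (2 * d / n)) ^ m := (mul_pow _ _ _).symm
    _ ≤ Real.exp (-1 / 2) ^ m := by gcongr
    _ = Real.exp (m * (-1 / 2)) := (Real.exp_nat_mul _ _).symm
    _ ≤ Real.exp (-(lam * δ * d * w / 16)) := by
        apply Real.exp_le_exp.2
        linarith

/-- The weight of the graph `G` under `G(n,q)`. -/
def gnpWeight (q : ℝ) (G : SimpleGraph (Fin n)) : ℝ :=
  q ^ edgeCount G * (1 - q) ^ (n.choose 2 - edgeCount G)

lemma gnpWeight_nonneg {q : ℝ} (h0 : 0 ≤ q) (h1 : q ≤ 1) (G : SimpleGraph (Fin n)) :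
    0 ≤ gnpWeight q G :=
  mul_nonneg (pow_nonneg h0 _) (pow_nonneg (sub_nonneg.2 h1) _)

lemma edgeCount_eq_card (G : SimpleGraph (Fin n)) : edgeCount G = G.edgeFinset.card := by
  rw [edgeCount, ← SimpleGraph.coe_edgeFinset, Set.ncard_coe_finset]

/-- The probability that `G(n,q)` contains a given set `A` of edges is `q ^ |A|`. -/
lemma sum_gnpWeight_containing (q : ℝ) (A : Finset (Sym2 (Fin n)))
    (hA : A ⊆ (⊤ : SimpleGraph (Fin n)).edgeFinset) :
    ∑ G ∈ Finset.univ.filter (fun G : SimpleGraph (Fin n) => A ⊆ G.edgeFinset), gnpWeight q G =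
      q ^ A.card := by
  set E := (⊤ : SimpleGraph (Fin n)).edgeFinset with hE
  have hEc : E.card = n.choose 2 := by
    rw [hE, SimpleGraph.card_edgeFinset_top_eq_card_choose_two, Fintype.card_fin]
  have hGE : ∀ G : SimpleGraph (Fin n), G.edgeFinset ⊆ E := fun G =>
    SimpleGraph.edgeFinset_subset_edgeFinset.2 le_top
  have hmem : ∀ (G : SimpleGraph (Fin n)) e, e ∈ G.edgeFinset ↔ e ∈ G.edgeSet :=
    fun _ _ => SimpleGraph.mem_edgeFinset
  have hinv : ∀ T ⊆ E, ∀ e,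
      e ∈ (SimpleGraph.fromEdgeSet ((A : Set (Sym2 (Fin n))) ∪ T)).edgeSet ↔ e ∈ A ∨ e ∈ T := by
    intro T hT e
    rw [SimpleGraph.edgeSet_fromEdgeSet, Set.mem_sdiff, Set.mem_union,
      Finset.mem_coe, Finset.mem_coe, and_iff_left_iff_imp]
    intro he
    simpa [hE] using he.elim (fun h => hA h) fun h => hT h
  have key : ∑ G ∈ Finset.univ.filter (fun G : SimpleGraph (Fin n) => A ⊆ G.edgeFinset),
      gnpWeight q G =
      ∑ T ∈ (E \ A).powerset, q ^ A.card * (q ^ T.card * (1 - q) ^ ((E \ A).card - T.card)) := by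
    refine Finset.sum_bij' (fun G _ => G.edgeFinset \ A)
      (fun T _ => SimpleGraph.fromEdgeSet ((A : Set (Sym2 (Fin n))) ∪ T)) ?_ ?_ ?_ ?_ ?_
    · intro G _
      exact Finset.mem_powerset.2 (Finset.sdiff_subset_sdiff (hGE G) subset_rfl)
    · intro T hT
      have hT' := (Finset.mem_powerset.1 hT).trans Finset.sdiff_subset
      refine Finset.mem_filter.2 ⟨Finset.mem_univ _, fun e he => ?_⟩
      exact (hmem _ e).2 ((hinv T hT' e).2 (Or.inl he))
    · intro G hG
      have hG' := (Finset.mem_filter.1 hG).2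
      rw [← SimpleGraph.edgeSet_inj]
      ext e
      have he : e ∈ A → e ∈ G.edgeSet := fun h => (hmem G e).1 (hG' h)
      rw [hinv _ (Finset.sdiff_subset.trans (hGE G)), Finset.mem_sdiff, hmem]
      tauto
    · intro T hT
      have hT' := Finset.mem_powerset.1 hT
      ext e
      have he : e ∈ T → e ∉ A := fun h => (Finset.mem_sdiff.1 (hT' h)).2
      rw [Finset.mem_sdiff, hmem, hinv T (hT'.trans Finset.sdiff_subset)]
      tauto
    · intro G hG
      have hG' := (Finset.mem_filter.1 hG).2
      have h1 := Finset.card_sdiff_of_subset hG'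
      have h2 := Finset.card_sdiff_of_subset hA
      have h3 := Finset.card_le_card hG'
      rw [gnpWeight, edgeCount_eq_card, ← mul_assoc, ← pow_add, h1, h2, hEc]
      congr 2 <;> omega
  rw [key, ← Finset.mul_sum, Finset.sum_pow_mul_eq_add_pow]
  simp

lemma sum_biUnion_le_of_nonneg {ι α : Type*} (s : Finset ι) (t : ι → Finset α)
    (f : α → ℝ) (hf : ∀ a, 0 ≤ f a) : ∑ a ∈ s.biUnion t, f a ≤ ∑ i ∈ s, ∑ a ∈ t i, f a := by
  induction s using Finset.induction_on with
  | empty => simp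
  | insert i s hi ih =>
    rw [Finset.biUnion_insert, Finset.sum_insert hi]
    have h1 := Finset.sum_union_inter (s₁ := t i) (s₂ := s.biUnion t) (f := f)
    have h2 := Finset.sum_nonneg fun a (_ : a ∈ t i ∩ s.biUnion t) => hf a
    linarith

lemma sum_gnpWeight_le_deg {q : ℝ} (h0 : 0 ≤ q) (h1 : q ≤ 1) (k : ℕ) :
    ∑ G ∈ Finset.univ.filter (fun G : SimpleGraph (Fin n) => ∃ v, k ≤ deg G v), gnpWeight q G ≤
      n * (n.choose k * q ^ k) := by
  set A : Fin n → Finset (Fin n) → Finset (Sym2 (Fin n)) := fun v S => S.image fun w => s(v, w)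
  have hsub : Finset.univ.filter (fun G : SimpleGraph (Fin n) => ∃ v, k ≤ deg G v) ⊆
      (Finset.univ : Finset (Fin n)).biUnion fun v =>
        ((Finset.univ : Finset (Fin n)).powersetCard k).biUnion fun S =>
          Finset.univ.filter fun G : SimpleGraph (Fin n) => A v S ⊆ G.edgeFinset := by
    intro G hG
    obtain ⟨v, hv⟩ := (Finset.mem_filter.1 hG).2
    rw [deg_eq_card] at hv
    obtain ⟨S, hS, hSk⟩ := Finset.exists_subset_card_eq hv
    simp only [Finset.mem_biUnion, Finset.mem_filter, Finset.mem_univ, true_and,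
      Finset.mem_powersetCard]
    refine ⟨v, S, ⟨Finset.subset_univ _, hSk⟩, ?_⟩
    intro e he
    obtain ⟨w, hw, rfl⟩ := Finset.mem_image.1 he
    simpa using hS hw
  have hterm : ∀ v, ∀ S ∈ (Finset.univ : Finset (Fin n)).powersetCard k,
      ∑ G ∈ Finset.univ.filter (fun G : SimpleGraph (Fin n) => A v S ⊆ G.edgeFinset),
        gnpWeight q G ≤ q ^ k := by
    intro v S hS
    have hSk := (Finset.mem_powersetCard.1 hS).2
    by_cases hv : v ∈ S
    · rw [Finset.filter_false_of_mem, Finset.sum_empty]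
      · exact pow_nonneg h0 k
      · intro G _ hG
        have := hG (Finset.mem_image_of_mem (fun w => s(v, w)) hv)
        simp at this
    · have hA : A v S ⊆ (⊤ : SimpleGraph (Fin n)).edgeFinset := by
        intro e he
        obtain ⟨w, hw, rfl⟩ := Finset.mem_image.1 he
        rw [SimpleGraph.mem_edgeFinset, SimpleGraph.mem_edgeSet, SimpleGraph.top_adj]
        rintro rfl
        exact hv hw
      rw [sum_gnpWeight_containing q _ hA, Finset.card_image_of_injective _
        (fun a b h => Sym2.congr_right.1 h), hSk]
  calc _ ≤ _ := Finset.sum_le_sum_of_subset_of_nonneg hsub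
          fun G _ _ => gnpWeight_nonneg h0 h1 G
    _ ≤ ∑ v : Fin n, ∑ S ∈ (Finset.univ : Finset (Fin n)).powersetCard k,
          ∑ G ∈ Finset.univ.filter (fun G : SimpleGraph (Fin n) => A v S ⊆ G.edgeFinset),
            gnpWeight q G := by
        refine (sum_biUnion_le_of_nonneg _ _ _ (gnpWeight_nonneg h0 h1)).trans
          (Finset.sum_le_sum fun v _ => sum_biUnion_le_of_nonneg _ _ _ (gnpWeight_nonneg h0 h1))
    _ ≤ ∑ v : Fin n, ∑ S ∈ (Finset.univ : Finset (Fin n)).powersetCard k, q ^ k :=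
        Finset.sum_le_sum fun v _ => Finset.sum_le_sum (hterm v)
    _ = _ := by simp

/-- Some vertex of `G` has degree at least `7δ`. -/
def HasLargeDeg (δ : ℝ) (G : SimpleGraph (Fin n)) : Prop := ∃ v, 7 * δ ≤ deg G v

/-- The maximum degree of `G(n, 2δ/n)` is unlikely to reach `7δ`. -/
lemma sum_gnpWeight_deg_ge_le {δ : ℝ} (hδ : 0 < δ) :
    ∑ G : SimpleGraph (Fin n), (if HasLargeDeg δ G then
        ENNReal.ofReal (gnpWeight (2 * δ / n) G) else 0) ≤
      ENNReal.ofReal (n * Real.exp (-(7 * δ / 5))) := by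
  set q := 2 * δ / n with hq
  have hq0 : 0 ≤ q := by positivity
  rw [← Finset.sum_filter]
  rcases le_or_gt q 1 with hq1 | hq1
  · set k := ⌈7 * δ⌉₊ with hk
    have hk0 : 0 < k := Nat.ceil_pos.2 (by positivity)
    have hkδ : 7 * δ ≤ k := Nat.le_ceil _
    have hfil : Finset.univ.filter (HasLargeDeg δ) =
        Finset.univ.filter (fun G : SimpleGraph (Fin n) => ∃ v, k ≤ deg G v) := by
      refine Finset.filter_congr fun G _ => ?_
      simp only [HasLargeDeg, hk, Nat.ceil_le]
    rw [hfil, ← ENNReal.ofReal_sum_of_nonneg fun G _ => gnpWeight_nonneg hq0 hq1 G]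
    refine ENNReal.ofReal_le_ofReal ((sum_gnpWeight_le_deg hq0 hq1 k).trans ?_)
    rcases Nat.eq_zero_or_pos n with rfl | hn
    · simp
    have hn' : (0 : ℝ) < n := by exact_mod_cast hn
    have hk' : (0 : ℝ) < k := by exact_mod_cast hk0
    gcongr
    have hbase : Real.exp 1 * n / k * q ≤ Real.exp (-1 / 5) := by
      have h1 : Real.exp 1 * n / k * q = 2 * δ * Real.exp 1 / k := by
        rw [hq]; field_simp
      have h2 : 2 * δ * Real.exp 1 / k ≤ 2 / 7 * Real.exp 1 := by
        rw [div_le_iff₀ hk']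
        nlinarith [Real.exp_pos 1]
      have h5 := Real.exp_one_lt_d9
      have h6 : (0.8 : ℝ) ≤ Real.exp (-1 / 5) := by
        have := Real.add_one_le_exp (-1 / 5 : ℝ)
        linarith
      rw [h1]; linarith
    calc (n.choose k : ℝ) * q ^ k ≤ (Real.exp 1 * n / k) ^ k * q ^ k := by
          gcongr
          exact choose_le_exp_mul_div_pow _ hk0
      _ = (Real.exp 1 * n / k * q) ^ k := (mul_pow _ _ _).symm
      _ ≤ Real.exp (-1 / 5) ^ k := by gcongr
      _ = Real.exp (k * (-1 / 5)) := (Real.exp_nat_mul _ _).symm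
      _ ≤ Real.exp (-(7 * δ / 5)) := Real.exp_le_exp.2 (by linarith)
  · rw [Finset.filter_false_of_mem, Finset.sum_empty]
    · exact zero_le
    · rintro G - ⟨v, hv⟩
      have hn : (0 : ℝ) < n := by exact_mod_cast v.pos
      rw [hq, lt_div_iff₀ hn] at hq1
      have h1 : deg G v ≤ n := by
        rw [deg_eq_card]
        exact (Finset.card_le_univ _).trans_eq (Fintype.card_fin n)
      have h2 : (deg G v : ℝ) ≤ n := by exact_mod_cast h1
      linarith

/-- The set `W ∪ N_F(W)`. -/
def closedNbhd (F : SimpleGraph (Fin n)) (W : Finset (Fin n)) : Finset (Fin n) :=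
  W ∪ W.biUnion fun v => Finset.univ.filter (F.Adj v)

lemma union_nbhd_subset (F : SimpleGraph (Fin n)) (W : Finset (Fin n)) :
    (W : Set (Fin n)) ∪ nbhd F W ⊆ closedNbhd F W := by
  rintro x (hx | ⟨-, u, hu, hux⟩)
  · exact Finset.mem_union_left _ hx
  · exact Finset.mem_union_right _ (Finset.mem_biUnion.2 ⟨u, hu, by simpa using hux⟩)

lemma card_closedNbhd_le (F : SimpleGraph (Fin n)) (W : Finset (Fin n)) {δ : ℝ} (hδ : 1 ≤ δ)
    (hF : ∀ v, (deg F v : ℝ) ≤ 7 * δ) : ((closedNbhd F W).card : ℝ) ≤ 8 * δ * W.card := by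
  have h1 : (closedNbhd F W).card ≤ W.card + ∑ v ∈ W, deg F v := by
    refine (Finset.card_union_le _ _).trans (Nat.add_le_add_left ?_ _)
    simp only [deg_eq_card]
    exact Finset.card_biUnion_le
  have h2 : ((closedNbhd F W).card : ℝ) ≤ W.card + ∑ v ∈ W, (deg F v : ℝ) := by exact_mod_cast h1
  have h3 := Finset.sum_le_card_nsmul W (fun v => (deg F v : ℝ)) _ fun v _ => hF v
  rw [nsmul_eq_mul] at h3
  have h4 : (0 : ℝ) ≤ W.card := Nat.cast_nonneg _
  nlinarith

/-- Some `W` has an unusually dense closed `F`-neighbourhood in `K`. -/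
def HasDenseNbhd (lam δ : ℝ) (d : ℕ) (F K : SimpleGraph (Fin n)) : Prop :=
  ∃ W : Finset (Fin n), W.Nonempty ∧ δ * W.card ≤ 4 * lam * n / 10 ^ 4 ∧
    lam * δ * d * W.card / 8 < edgesWithin K (closedNbhd F W)

lemma card_hasDenseNbhd_le {d : ℕ} (hd : 1 ≤ d) (hdn : 16 * d ≤ n) {lam δ : ℝ}
    (hlam : 0 < lam) (hlam1 : lam ≤ 1) (hδ : 1 ≤ δ) (F : SimpleGraph (Fin n))
    (hF : ∀ v, (deg F v : ℝ) ≤ 7 * δ) (hsmall : n * Real.exp (-(lam * δ * d / 16)) ≤ 1) :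
    (((regularContaining d ∅).filter (HasDenseNbhd lam δ d F)).card : ℝ) ≤
      2 * (n * Real.exp (-(lam * δ * d / 16))) * (regularContaining (n := n) d ∅).card := by
  set t := Real.exp (-(lam * δ * d / 16)) with ht
  have ht0 : 0 < t := Real.exp_pos _
  set N : ℝ := ((regularContaining (n := n) d ∅).card : ℝ)
  set 𝒲 : Finset (Finset (Fin n)) := Finset.univ.filter fun W : Finset (Fin n) =>
    W.Nonempty ∧ δ * W.card ≤ 4 * lam * n / 10 ^ 4
  have hsub : (regularContaining d ∅).filter (HasDenseNbhd lam δ d F) ⊆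
      𝒲.biUnion fun W => (regularContaining d ∅).filter fun K : SimpleGraph (Fin n) =>
        lam * δ * d * W.card / 8 < edgesWithin K (closedNbhd F W) := by
    intro K hK
    obtain ⟨hK, W, hW, hWn, hWe⟩ := Finset.mem_filter.1 hK
    exact Finset.mem_biUnion.2 ⟨W, by simp [𝒲, hW, hWn], Finset.mem_filter.2 ⟨hK, hWe⟩⟩
  have hterm : ∀ W ∈ 𝒲, (((regularContaining d ∅).filter fun K : SimpleGraph (Fin n) =>
      lam * δ * d * W.card / 8 < edgesWithin K (closedNbhd F W)).card : ℝ) ≤ t ^ W.card * N := by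
    intro W hW
    obtain ⟨-, hne, hWn⟩ := Finset.mem_filter.1 hW
    have hw : (0 : ℝ) < W.card := by exact_mod_cast hne.card_pos
    refine (card_regular_lt_edgesWithin hd hdn hlam hlam1 (by linarith) hw hWn _
      (card_closedNbhd_le F W hδ hF)).trans_eq ?_
    rw [ht, ← Real.exp_nat_mul]
    congr 2
    ring
  have hsum : ∑ W ∈ 𝒲, t ^ W.card ≤ 2 * (n * t) := by
    have h1 : ∑ W ∈ 𝒲, t ^ W.card + t ^ (∅ : Finset (Fin n)).card ≤ (t + 1) ^ n := by
      have h2 := Finset.sum_pow_mul_eq_add_pow t 1 (Finset.univ : Finset (Fin n))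
      simp only [one_pow, mul_one, Finset.card_univ, Fintype.card_fin, Finset.powerset_univ] at h2
      rw [← h2, add_comm, ← Finset.sum_insert (f := fun W : Finset (Fin n) => t ^ W.card)
        (show ∅ ∉ 𝒲 by simp [𝒲])]
      exact Finset.sum_le_sum_of_subset_of_nonneg (Finset.subset_univ _) fun W _ _ => by positivity
    have h3 : (t + 1) ^ n ≤ Real.exp (n * t) := by
      rw [Real.exp_nat_mul]
      gcongr
      exact Real.add_one_le_exp t
    have h4 : |(n : ℝ) * t| ≤ 1 := by rwa [abs_of_nonneg (by positivity)]
    have h5 := (le_abs_self _).trans (Real.abs_exp_sub_one_le h4)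
    rw [abs_of_nonneg (by positivity)] at h5
    rw [Finset.card_empty, pow_zero] at h1
    linarith
  calc (((regularContaining d ∅).filter (HasDenseNbhd lam δ d F)).card : ℝ)
      ≤ ∑ W ∈ 𝒲, (((regularContaining d ∅).filter fun K : SimpleGraph (Fin n) =>
      lam * δ * d * W.card / 8 < edgesWithin K (closedNbhd F W)).card : ℝ) := by
        exact_mod_cast (Finset.card_le_card hsub).trans Finset.card_biUnion_le
    _ ≤ ∑ W ∈ 𝒲, t ^ W.card * N := Finset.sum_le_sum hterm
    _ ≤ 2 * (n * t) * N := by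
        rw [← Finset.sum_mul]
        gcongr

/-- The mass of the graph `K` under the uniform distribution on `d`-regular graphs. -/
def regularMass (d : ℕ) (K : SimpleGraph (Fin n)) : ℝ≥0∞ :=
  if IsRegularGraph K d then
    ({G : SimpleGraph (Fin n) | IsRegularGraph G d}.ncard : ℝ≥0∞)⁻¹ else 0

lemma sum_regularMass (d : ℕ) (Q : SimpleGraph (Fin n) → Prop) :
    ∑ K, (if Q K then regularMass d K else 0) =
      ((regularContaining d ∅).filter Q).card * ((regularContaining (n := n) d ∅).card : ℝ≥0∞)⁻¹ := by
  have h1 : {G : SimpleGraph (Fin n) | IsRegularGraph G d}.ncard =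
      (regularContaining (n := n) d ∅).card := by
    rw [← Set.ncard_coe_finset]
    congr 1
    ext K
    simp [mem_regularContaining]
  rw [← nsmul_eq_mul, ← Finset.sum_const, ← Finset.sum_filter]
  simp only [regularMass, h1]
  rw [← Finset.sum_filter, Finset.filter_filter]
  refine Finset.sum_congr ?_ fun _ _ => rfl
  ext K
  simp [mem_regularContaining, and_comm]

lemma sum_regularMass_le {d : ℕ} {Q R : SimpleGraph (Fin n) → Prop} {ε : ℝ} (hε : 0 ≤ ε)
    (hQR : ∀ K, Q K → R K) (h : (((regularContaining d ∅).filter R).card : ℝ) ≤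
      ε * (regularContaining (n := n) d ∅).card) :
    ∑ K, (if Q K then regularMass d K else 0) ≤ ENNReal.ofReal ε := by
  rw [sum_regularMass]
  have h1 : ((regularContaining d ∅).filter Q).card ≤ ((regularContaining d ∅).filter R).card :=
    Finset.card_le_card (Finset.monotone_filter_right _ fun K _ => hQR K)
  have h2 := ENNReal.ofReal_le_ofReal ((Nat.cast_le.2 h1).trans h)
  rw [ENNReal.ofReal_mul hε, ENNReal.ofReal_natCast, ENNReal.ofReal_natCast] at h2
  calc _ ≤ ENNReal.ofReal ε * (regularContaining (n := n) d ∅).card *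
        ((regularContaining (n := n) d ∅).card : ℝ≥0∞)⁻¹ := by gcongr
    _ ≤ ENNReal.ofReal ε * 1 := by
        rw [mul_assoc]
        gcongr
        exact ENNReal.mul_inv_le_one _
    _ = _ := mul_one _

lemma sum_regularMass_eq_zero_or_one (d : ℕ) :
    ∑ K : SimpleGraph (Fin n), regularMass d K = 0 ∨
      ∑ K : SimpleGraph (Fin n), regularMass d K = 1 := by
  have h := sum_regularMass (n := n) d fun _ => True
  simp only [if_true, Finset.filter_true] at h
  rw [h]
  rcases Nat.eq_zero_or_pos (regularContaining (n := n) d ∅).card with h0 | h0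
  · simp [h0]
  · exact Or.inr (ENNReal.mul_inv_cancel (by exact_mod_cast h0.ne') (ENNReal.natCast_ne_top _))

lemma prEvent_add_prEvent_not {α : Type*} (μ : PMF α) (P : α → Prop) :
    prEvent μ P + prEvent μ (fun a => ¬ P a) = 1 := by
  rw [prEvent, prEvent, ← ENNReal.tsum_add, ← μ.tsum_coe]
  refine tsum_congr fun a => ?_
  by_cases h : P a <;> simp [h]

/-- The edge bound holds for `(K, F)` if `F` has small maximum degree and `K` has no dense closed
`F`-neighbourhood. -/
lemma edgesWithin_le_of_not_hasDenseNbhd {d : ℕ} {lam δ : ℝ} (hlam : 0 < lam) (hδ : 0 < δ)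
    {F K : SimpleGraph (Fin n)} (h : ¬ HasDenseNbhd lam δ d F K) (U : Set (Fin n))
    (hU : (U.ncard : ℝ) ≤ lam * n / 10 ^ 4)
    (hW : ∃ W : Set (Fin n), (W.ncard : ℝ) ≤ 4 * U.ncard / δ ∧ U ⊆ W ∪ nbhd F W) :
    (edgesWithin K U : ℝ) ≤ lam * d / 2 * U.ncard := by
  obtain ⟨W', hWc, hUW⟩ := hW
  obtain ⟨W, rfl⟩ : ∃ W : Finset (Fin n), (W : Set (Fin n)) = W' := ⟨W'.toFinset, by simp⟩
  rw [Set.ncard_coe_finset, le_div_iff₀ hδ] at hWc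
  have hmono : edgesWithin K U ≤ edgesWithin K (closedNbhd F W) :=
    edgesWithin_mono K (hUW.trans (union_nbhd_subset F W))
  rcases W.eq_empty_or_nonempty with rfl | hne
  · have h1 : edgesWithin K (closedNbhd F ∅) = 0 := by
      rw [edgesWithin_eq_card, Finset.card_eq_zero, Finset.filter_eq_empty_iff]
      intro e _ he
      induction e with
      | _ a b => simpa [closedNbhd] using he a (by simp)
    rw [h1, Nat.le_zero] at hmono
    rw [hmono, Nat.cast_zero]
    positivity
  · by_contra hcon
    push Not at hcon
    refine h ⟨W, hne, by linarith, ?_⟩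
    have h1 : (edgesWithin K U : ℝ) ≤ edgesWithin K (closedNbhd F W) := by exact_mod_cast hmono
    have h2 : lam * d * (W.card * δ) ≤ lam * d * (4 * U.ncard) := by gcongr
    linarith

/-- Under a product law, consider an event for the second coordinate and an event which is rare
for the first coordinate given any second coordinate outside the former event. -/
lemma sum_mul_le_of_fibers {α β : Type*} [Fintype α] [Fintype β] (a : α → ℝ≥0∞) (b : β → ℝ≥0∞)
    (ha : ∑ x, a x ≤ 1) (hb : ∑ y, b y ≤ 1) (P : α × β → Prop) (B : β → Prop)
    {ε₁ ε₂ : ℝ≥0∞} (h1 : ∑ y, (if B y then b y else 0) ≤ ε₁)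
    (h2 : ∀ y, ¬ B y → ∑ x, (if P (x, y) then a x else 0) ≤ ε₂) :
    ∑ w : α × β, (if P w then a w.1 * b w.2 else 0) ≤ ε₁ + ε₂ := by
  have hfib : ∀ y, ∑ x, (if P (x, y) then a x * b y else 0) ≤
      (if B y then b y else 0) + ε₂ * b y := by
    intro y
    have h3 : ∑ x, (if P (x, y) then a x * b y else 0) =
        (∑ x, (if P (x, y) then a x else 0)) * b y := by
      rw [Finset.sum_mul]
      exact Finset.sum_congr rfl fun x _ => by split_ifs <;> simp
    rw [h3]
    by_cases hB : B y
    · rw [if_pos hB]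
      have h4 : ∑ x, (if P (x, y) then a x else 0) ≤ 1 := by
        refine (Finset.sum_le_sum fun x _ => ?_).trans ha
        split_ifs <;> simp
      calc _ ≤ 1 * b y := by gcongr
        _ ≤ _ := by rw [one_mul]; exact le_self_add
    · rw [if_neg hB, zero_add]
      gcongr
      exact h2 y hB
  calc ∑ w : α × β, (if P w then a w.1 * b w.2 else 0)
      = ∑ y, ∑ x, (if P (x, y) then a x * b y else 0) := Fintype.sum_prod_type_right _
    _ ≤ ∑ y, ((if B y then b y else 0) + ε₂ * b y) := Finset.sum_le_sum fun y _ => hfib y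
    _ = ∑ y, (if B y then b y else 0) + ε₂ * ∑ y, b y := by
        rw [Finset.sum_add_distrib, Finset.mul_sum]
    _ ≤ ε₁ + ε₂ * 1 := by gcongr
    _ = ε₁ + ε₂ := by rw [mul_one]

/-- The conclusion of the edge bound for the pair `(K, F)`. -/
def EdgeBound (lam δ : ℝ) (d : ℕ) (w : SimpleGraph (Fin n) × SimpleGraph (Fin n)) : Prop :=
  ∀ U : Set (Fin n), (U.ncard : ℝ) ≤ lam * n / 10 ^ 4 →
    (∃ W : Set (Fin n), (W.ncard : ℝ) ≤ 4 * U.ncard / δ ∧ U ⊆ W ∪ nbhd w.2 W) →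
      (edgesWithin w.1 U : ℝ) ≤ lam * d / 2 * U.ncard

lemma prEvent_not_le {d : ℕ} (hd : 1 ≤ d) (hdn : 16 * d ≤ n) {lam δ : ℝ}
    (hlam : 0 < lam) (hlam1 : lam ≤ 1) (hδ : 1 ≤ δ)
    (hsmall : n * Real.exp (-(lam * δ * d / 16)) ≤ 1)
    (ν : PMF (SimpleGraph (Fin n) × SimpleGraph (Fin n))) (hν : IsRegIndepGnp ν d (2 * δ / n)) :
    prEvent ν (fun w => ¬ EdgeBound lam δ d w) ≤
      ENNReal.ofReal (n * Real.exp (-(7 * δ / 5))) +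
        ENNReal.ofReal (2 * (n * Real.exp (-(lam * δ * d / 16)))) := by
  have hδ0 : 0 < δ := by linarith
  have hν' : ∀ w, ν w = regularMass d w.1 * ENNReal.ofReal (gnpWeight (2 * δ / n) w.2) := hν
  have hsum : (∑ K : SimpleGraph (Fin n), regularMass d K) *
      ∑ F : SimpleGraph (Fin n), ENNReal.ofReal (gnpWeight (2 * δ / n) F) = 1 := by
    rw [Finset.sum_mul_sum, ← Fintype.sum_prod_type', ← ν.tsum_coe, tsum_fintype]
    exact Finset.sum_congr rfl fun w _ => (hν' w).symm
  have ha : ∑ K : SimpleGraph (Fin n), regularMass d K = 1 :=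
    (sum_regularMass_eq_zero_or_one d).resolve_left fun h0 => by simp [h0] at hsum
  rw [ha, one_mul] at hsum
  rw [prEvent, tsum_fintype, funext hν']
  refine sum_mul_le_of_fibers (regularMass d) (fun F => ENNReal.ofReal (gnpWeight (2 * δ / n) F))
    ha.le hsum.le (fun w => ¬ EdgeBound lam δ d w) (HasLargeDeg δ)
    (sum_gnpWeight_deg_ge_le hδ0) fun F hF => ?_
  simp only [HasLargeDeg, not_exists, not_le] at hF
  refine sum_regularMass_le (by positivity) (fun K hK => ?_)
    (card_hasDenseNbhd_le hd hdn hlam hlam1 hδ F (fun v => (hF v).le) hsmall)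
  by_contra hdense
  exact hK fun U hU hW => edgesWithin_le_of_not_hasDenseNbhd hlam hδ0 hdense U hU hW

/-- **Lemma 6.3.** There are absolute constants `c* > 0` and `C* ≥ 1` such that for every
`c > 0` and all sufficiently large `n`: with `(1/64)(log n)⁻⁴ ≤ λ ≤ c*`,
`C* log n ≤ d ≤ n/C*`, `dn` even, `δ ≥ C* log n` with `λδd ≥ C* log n`, `q = 2δ/n`, and
`(K,F)` an independent pair with `K ~ G_d(n)`, `F ~ G(n,q)`, with probability at least
`1 − c n⁻¹⁴`: for each `U ⊆ [n]`, if `|U| ≤ λn/10⁴` and there is `W` with `|W| ≤ 4|U|/δ`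
and `U ⊆ W ∪ N_F(W)`, then `e_K(U) ≤ (λd/2)|U|`. -/
theorem regular_expansion_edges :
    ∃ cstar Cstar : ℝ, 0 < cstar ∧ 1 ≤ Cstar ∧
      ∀ c : ℝ, 0 < c →
        ∃ n₀ : ℕ, ∀ n : ℕ, n₀ ≤ n →
          ∀ lam δ : ℝ, ∀ d : ℕ,
            ((64 : ℝ) * (Real.log n) ^ 4)⁻¹ ≤ lam → lam ≤ cstar →
            Cstar * Real.log n ≤ (d : ℝ) → (d : ℝ) ≤ (n : ℝ) / Cstar → Even (d * n) →
            Cstar * Real.log n ≤ δ → Cstar * Real.log n ≤ lam * δ * d →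
            ∀ ν : PMF (SimpleGraph (Fin n) × SimpleGraph (Fin n)),
              IsRegIndepGnp ν d (2 * δ / n) →
              ENNReal.ofReal (1 - c / (n : ℝ) ^ 14) ≤
                prEvent ν (fun w =>
                  ∀ U : Set (Fin n), (U.ncard : ℝ) ≤ lam * n / 10 ^ 4 →
                    (∃ W : Set (Fin n), (W.ncard : ℝ) ≤ 4 * U.ncard / δ ∧
                        U ⊆ W ∪ nbhd w.2 W) →
                      (edgesWithin w.1 U : ℝ) ≤ lam * d / 2 * U.ncard) := by
  refine ⟨1, 1000, one_pos, by norm_num, fun c hc => ⟨max 16 ⌈3 / c⌉₊, ?_⟩⟩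
  intro n hn lam δ d hlam hlam1 hd hdn _ hδ hprod ν hν
  have hn16 : (16 : ℝ) ≤ n := by exact_mod_cast (le_max_left _ _).trans hn
  have hnc : 3 / c ≤ n := (Nat.le_ceil _).trans (by exact_mod_cast (le_max_right _ _).trans hn)
  have hn0 : (0 : ℝ) < n := by linarith
  have hlog : 1 ≤ Real.log n := by
    rw [Real.le_log_iff_exp_le hn0]
    linarith [Real.exp_one_lt_d9]
  have hlam0 : 0 < lam := lt_of_lt_of_le (by positivity) hlam
  have hd1 : 1 ≤ d := by
    have : (1 : ℝ) ≤ d := by linarith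
    exact_mod_cast this
  have hdn16 : 16 * d ≤ n := by
    have : (16 : ℝ) * d ≤ n := by linarith
    exact_mod_cast this
  have hexp : Real.exp (-(16 * Real.log n)) = ((n : ℝ) ^ 16)⁻¹ := by
    rw [Real.exp_neg, mul_comm, Real.exp_mul, Real.exp_log hn0]
    norm_cast
  have hF : n * Real.exp (-(7 * δ / 5)) ≤ n * ((n : ℝ) ^ 16)⁻¹ := by
    rw [← hexp]
    gcongr
    linarith
  have hK : n * Real.exp (-(lam * δ * d / 16)) ≤ n * ((n : ℝ) ^ 16)⁻¹ := by
    rw [← hexp]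
    gcongr
    linarith
  have hn15 : n * ((n : ℝ) ^ 16)⁻¹ = 1 / (n : ℝ) ^ 15 := by field_simp
  rw [hn15] at hF hK
  have hsmall : 1 / (n : ℝ) ^ 15 ≤ 1 :=
    div_le_one_of_le₀ (one_le_pow₀ (by linarith)) (by positivity)
  have hbad := prEvent_not_le hd1 hdn16 hlam0 hlam1 (by linarith) (hK.trans hsmall) ν hν
  rw [← ENNReal.ofReal_add (by positivity) (by positivity)] at hbad
  have hfinal : 1 / (n : ℝ) ^ 15 + 2 * (1 / (n : ℝ) ^ 15) ≤ c / (n : ℝ) ^ 14 := by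
    have h1 : 1 / (n : ℝ) ^ 15 + 2 * (1 / (n : ℝ) ^ 15) = 3 / n / (n : ℝ) ^ 14 := by
      field_simp
      norm_num
    rw [h1]
    gcongr
    rw [div_le_iff₀ hn0]
    rw [div_le_iff₀ hc] at hnc
    linarith
  rw [ENNReal.ofReal_sub _ (by positivity), ENNReal.ofReal_one, tsub_le_iff_right,
    ← prEvent_add_prEvent_not ν]
  gcongr
  exact hbad.trans (ENNReal.ofReal_le_ofReal (by linarith))

end Sandwich
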